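/- arXiv:1704.05544 — 3 statements merged into one kernel-verified Lean document; each statement's English description precedes it below -/
import Mathlib

section
/- Let p be an odd prime, n a positive integer, N = p^n, and let (s_i)_{0≤i<N} be the Ding–Helleseth generalized cyclotomic sequence of period N with S(x) = ∑_{i=0}^{N-1} s_i x^i. Let ω_N = e^{2πi/N}. Then for every integer m with 0 ≤ m ≤ n−1 and every integer a of the form a = p^m·b where b is an integer coprime to p that is a quadratic non-residue modulo p (i.e., a mod p^n lies in p^m·D_1^{(p^{n-m})}), one has S(ω_N^a) = (p^m+1)/2 + p^m·η_0^{(p)}. -/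
open scoped Classical

/-- The `i`-th term of the Ding–Helleseth generalized cyclotomic sequence:
`dh p i = 1` if `i = 0` or if, writing `i = p^j·u` with `p ∤ u`, the integer
`u` is a quadratic non-residue modulo `p`; and `dh p i = 0` otherwise. -/
noncomputable def dh (p : ℕ) (i : ℕ) : ℕ :=
  if i = 0 ∨ ¬ IsSquare (((i / p ^ padicValNat p i : ℕ) : ZMod p)) then 1 else 0

/-- The Gaussian period `η_i^{(p)}`: the sum of `e^{2πic/p}` over the
quadratic residues (`i = 0`) resp. non-residues (`i = 1`) `c` modulo `p`
in `{1, ..., p-1}`. -/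
noncomputable def eta (p : ℕ) (i : ℕ) : ℂ :=
  ∑ c ∈ (Finset.range p).filter
      (fun c : ℕ => c ≠ 0 ∧ (IsSquare ((c : ZMod p)) ↔ i % 2 = 0)),
    Complex.exp (2 * (Real.pi : ℂ) * Complex.I * (c : ℂ) / (p : ℂ))
lemma dh_mul_p (p k : ℕ) (hp : p.Prime) : dh p (p * k) = dh p k := by
  haveI := Fact.mk hp
  rcases Nat.eq_zero_or_pos k with rfl | hk
  · simp
  · have h1 : padicValNat p (p * k) = padicValNat p k + 1 := by
      rw [padicValNat.mul hp.ne_zero hk.ne', padicValNat_self, add_comm]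
    have h2 : p * k / p ^ (padicValNat p k + 1) = k / p ^ padicValNat p k := by
      rw [pow_succ', Nat.mul_div_mul_left _ _ hp.pos]
    unfold dh
    rw [h1, h2]
    simp [hp.ne_zero]

lemma dh_unit (p r : ℕ) (h : ¬ p ∣ r) :
    dh p r = if ¬ IsSquare ((r : ZMod p)) then 1 else 0 := by
  have h0 : r ≠ 0 := by rintro rfl; simp at h
  unfold dh
  rw [padicValNat.eq_zero_of_not_dvd h]
  simp [h0]

lemma sum_range_mul_split (p K : ℕ) (f : ℕ → ℂ) :
    ∑ i ∈ Finset.range (p * K), f i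
      = ∑ k ∈ Finset.range K, ∑ r ∈ Finset.range p, f (p * k + r) := by
  induction K with
  | zero => simp
  | succ K ih => rw [Nat.mul_succ, Finset.sum_range_add, ih, Finset.sum_range_succ]

/-- indicator of nonresidue -/
noncomputable def nr (p : ℕ) (x : ZMod p) : ℂ := if ¬ IsSquare x then 1 else 0

lemma dh_split (p n : ℕ) (hp : p.Prime) (z : ℂ) :
    ∑ i ∈ Finset.range (p ^ (n+1)), (dh p i : ℂ) * z ^ i
      = ∑ k ∈ Finset.range (p ^ n), (dh p k : ℂ) * (z ^ p) ^ k
        + (∑ r ∈ Finset.range p, nr p r * z ^ r) *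
          ∑ k ∈ Finset.range (p ^ n), (z ^ p) ^ k := by
  rw [pow_succ', sum_range_mul_split, Finset.mul_sum, ← Finset.sum_add_distrib]
  refine Finset.sum_congr rfl fun k _ => ?_
  obtain ⟨q, rfl⟩ : ∃ q, p = q + 1 := ⟨p - 1, by have := hp.pos; omega⟩
  rw [Finset.sum_range_succ', Finset.sum_range_succ']
  have h0 : nr (q+1) ((0:ℕ) : ZMod (q+1)) = 0 := by simp [nr]
  rw [h0, zero_mul, add_zero, add_zero, dh_mul_p _ _ hp, pow_mul, add_comm, Finset.sum_mul]
  congr 1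
  refine Finset.sum_congr rfl fun r hr => ?_
  have hr' := Finset.mem_range.1 hr
  have hnd : ¬ (q + 1) ∣ ((q + 1) * k + (r + 1)) := by
    rw [Nat.dvd_add_right (dvd_mul_right _ _)]
    exact Nat.not_dvd_of_pos_of_lt (by omega) (by omega)
  have hc : (((q + 1) * k + (r + 1) : ℕ) : ZMod (q+1)) = ((r + 1 : ℕ) : ZMod (q+1)) := by
    rw [Nat.cast_add, Nat.cast_mul, ZMod.natCast_self, zero_mul, zero_add]
  rw [dh_unit _ _ hnd, hc, pow_add, pow_mul]
  unfold nr
  push_cast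
  ring

lemma sum_range_zmod (p : ℕ) [NeZero p] (G : ZMod p → ℂ) :
    ∑ r ∈ Finset.range p, G (r : ZMod p) = ∑ x : ZMod p, G x := by
  refine Finset.sum_bij' (fun r _ => (r : ZMod p)) (fun x _ => x.val) ?_ ?_ ?_ ?_ ?_
  · simp
  · intro x _; simpa using ZMod.val_lt x
  · intro r hr; exact ZMod.val_cast_of_lt (Finset.mem_range.1 hr)
  · simp
  · simp

lemma nonres_mul (p : ℕ) [Fact p.Prime] (b x : ZMod p) (hb : ¬ IsSquare b) (hx : x ≠ 0) :
    IsSquare (b * x) ↔ ¬ IsSquare x := by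
  have hb0 : b ≠ 0 := by rintro rfl; simp at hb
  by_cases h2 : ringChar (ZMod p) = 2
  · exact absurd (FiniteField.isSquare_of_char_two h2 b) hb
  rw [← quadraticChar_one_iff_isSquare (mul_ne_zero hb0 hx), map_mul,
    quadraticChar_neg_one_iff_not_isSquare.2 hb]
  rw [← quadraticChar_neg_one_iff_not_isSquare]
  constructor <;> intro h <;> linarith

lemma nr_sum (p : ℕ) [Fact p.Prime] (b : ZMod p) (hb : ¬ IsSquare b) (F : ZMod p → ℂ) :
    ∑ x : ZMod p, nr p x * F (b * x)
      = ∑ x : ZMod p, (if x ≠ 0 ∧ IsSquare x then 1 else 0) * F x := by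
  have hb0 : b ≠ 0 := by rintro rfl; simp at hb
  rw [← Equiv.sum_comp (Equiv.mulLeft₀ b hb0) (fun x => (if x ≠ 0 ∧ IsSquare x then 1 else 0) * F x)]
  refine Finset.sum_congr rfl fun x _ => ?_
  simp only [Equiv.mulLeft₀_apply]
  congr 1
  unfold nr
  by_cases hx : x = 0
  · subst hx; simp
  · have := nonres_mul p b x hb hx
    simp [hx, hb0, this]

lemma nr_count (p : ℕ) [Fact p.Prime] (b : ZMod p) (hb : ¬ IsSquare b) :
    ∑ x : ZMod p, nr p x = ((p : ℂ) - 1) / 2 := by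
  have h := nr_sum p b hb (fun _ => 1)
  simp only [mul_one] at h
  have h2 : ∑ x : ZMod p, nr p x + ∑ x : ZMod p, (if x ≠ 0 ∧ IsSquare x then (1:ℂ) else 0)
      + ∑ x : ZMod p, (if x = 0 then (1:ℂ) else 0) = p := by
    rw [← Finset.sum_add_distrib, ← Finset.sum_add_distrib]
    trans ∑ x : ZMod p, (1:ℂ)
    · refine Finset.sum_congr rfl fun x _ => ?_
      unfold nr
      by_cases hx : x = 0
      · subst hx; simp
      · by_cases hs : IsSquare x <;> simp [hx, hs]
    · simp [ZMod.card]
  rw [← h, Finset.sum_ite_eq' Finset.univ (0 : ZMod p)] at h2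
  simp only [Finset.mem_univ, if_true] at h2
  linear_combination h2 / 2

lemma dh_count (p : ℕ) [Fact p.Prime] (b : ZMod p) (hb : ¬ IsSquare b) (m : ℕ) :
    ∑ k ∈ Finset.range (p ^ m), (dh p k : ℂ) = ((p : ℂ) ^ m + 1) / 2 := by
  induction m with
  | zero => rw [pow_zero, Finset.sum_range_one]; simp [dh]
  | succ m ih =>
    have h := dh_split p m Fact.out 1
    simp only [one_pow, mul_one] at h
    rw [h, ih, sum_range_zmod p (nr p), nr_count p b hb]
    simp
    ring

lemma eta_eq (p : ℕ) [Fact p.Prime] :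
    eta p 0 = ∑ x : ZMod p, (if x ≠ 0 ∧ IsSquare x then 1 else 0) * ZMod.stdAddChar x := by
  rw [← sum_range_zmod p (fun x => (if x ≠ 0 ∧ IsSquare x then 1 else 0) * ZMod.stdAddChar x)]
  unfold eta
  rw [Finset.sum_filter]
  refine Finset.sum_congr rfl fun c hc => ?_
  have hc' := Finset.mem_range.1 hc
  have h0 : (c : ZMod p) = 0 ↔ c = 0 := by
    rw [ZMod.natCast_eq_zero_iff]
    exact ⟨fun h => Nat.eq_zero_of_dvd_of_lt h hc', fun h => h ▸ dvd_zero _⟩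
  have he := ZMod.stdAddChar_coe (N := p) (c : ℤ)
  push_cast at he
  rw [he]
  simp [h0]

lemma main_aux (p : ℕ) [Fact p.Prime] (b : ℤ) (hb : ¬ IsSquare ((b : ZMod p))) (m d : ℕ)
    (z : ℂ) (hz : z = Complex.exp (2 * (Real.pi : ℂ) * Complex.I * (b : ℂ) / ((p : ℂ) ^ (d + 1)))) :
    ∑ i ∈ Finset.range (p ^ (m + d + 1)), (dh p i : ℂ) * z ^ i
      = ((p : ℂ) ^ m + 1) / 2 + (p : ℂ) ^ m * eta p 0 := by
  have hp : p.Prime := Fact.out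
  have hp0 : (p : ℂ) ≠ 0 := by exact_mod_cast hp.ne_zero
  have hpI : (2 * (Real.pi : ℂ) * Complex.I) ≠ 0 := Complex.two_pi_I_ne_zero
  have hzp : z ^ p = Complex.exp (2 * (Real.pi : ℂ) * Complex.I * (b : ℂ) / ((p : ℂ) ^ d)) := by
    rw [hz, ← Complex.exp_nat_mul]
    congr 1
    field_simp
    ring
  induction d generalizing z with
  | zero =>
    have hz1 : z ^ p = 1 := by
      rw [hzp, Complex.exp_eq_one_iff]
      exact ⟨b, by simp; ring⟩
    have hzr : ∀ r : ℕ, z ^ r = ZMod.stdAddChar ((b : ZMod p) * (r : ZMod p)) := by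
      intro r
      have he := ZMod.stdAddChar_coe (N := p) (b * r)
      push_cast at he
      rw [he, hz, ← Complex.exp_nat_mul]
      congr 1
      simp
      ring
    rw [add_zero, dh_split p m hp, hz1]
    simp only [one_pow, mul_one]
    simp only [hzr]
    rw [dh_count p b hb,
      sum_range_zmod p (fun x => nr p x * ZMod.stdAddChar ((b : ZMod p) * x)),
      nr_sum p b hb (fun x => ZMod.stdAddChar x), ← eta_eq]
    simp
    ring
  | succ d ih =>
    have hne : z ^ p ≠ 1 := by
      rw [hzp, Ne, Complex.exp_eq_one_iff]
      rintro ⟨t, ht⟩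
      have h1 : (b : ℂ) = t * p ^ (d + 1) := by
        field_simp at ht
        linear_combination ht
      have h2 : b = t * p ^ (d + 1) := by exact_mod_cast h1
      apply hb
      rw [h2]
      simp
    have hone : (z ^ p) ^ (p ^ (m + d + 1)) = 1 := by
      rw [hzp, ← Complex.exp_nat_mul, Complex.exp_eq_one_iff]
      refine ⟨b * p ^ m, ?_⟩
      push_cast
      field_simp
      ring
    have hg : ∑ k ∈ Finset.range (p ^ (m + d + 1)), (z ^ p) ^ k = 0 := by
      rw [geom_sum_eq hne, hone]; simp
    rw [← add_assoc m d 1, dh_split p _ hp, hg, mul_zero, add_zero]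
    refine ih (z ^ p) hzp ?_
    rw [hzp, ← Complex.exp_nat_mul]
    congr 1
    field_simp
    ring

theorem stmt_14 (p n : ℕ) (hp : p.Prime) (hodd : Odd p) (hn : 0 < n) :
    ∀ m : ℕ, m ≤ n - 1 → ∀ b : ℤ, ¬ (p : ℤ) ∣ b → ¬ IsSquare ((b : ZMod p)) →
      ∑ i ∈ Finset.range (p ^ n), (dh p i : ℂ) *
        Complex.exp (2 * (Real.pi : ℂ) * Complex.I
          * ((p : ℂ) ^ m * (b : ℂ)) * (i : ℂ) / ((p : ℂ) ^ n))
        = ((p : ℂ) ^ m + 1) / 2 + (p : ℂ) ^ m * eta p 0 := by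
  intro m hm b _ hb
  haveI := Fact.mk hp
  have hp0 : (p : ℂ) ≠ 0 := by exact_mod_cast hp.ne_zero
  obtain ⟨d, rfl⟩ : ∃ d, n = m + d + 1 := ⟨n - 1 - m, by omega⟩
  rw [← main_aux p b hb m d _ rfl]
  refine Finset.sum_congr rfl fun i _ => ?_
  rw [← Complex.exp_nat_mul]
  congr 2
  rw [add_assoc, pow_add]
  field_simp
end

section
/- Let p be an odd prime, n a positive integer, N = p^n, let (s_i)_{0≤i<N} be the Ding–Helleseth generalized cyclotomic sequence of period N, and let A be the N×N integer circulant matrix with entries a_{i,j} = s_{(i−j) mod N}. Then gcd(det(A), 2^N − 1) divides 2^{p^{n-1}} − 1. -/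
open scoped Classical

/-- The quadratic character of `ZMod p`, with integer values. -/
noncomputable def chi (p : ℕ) [Fact p.Prime] : MulChar (ZMod p) ℤ := quadraticChar (ZMod p)

/-- The signed version of the sequence. -/
noncomputable def cc (p : ℕ) [Fact p.Prime] (i : ℕ) : ℤ :=
  if i = 0 then 0 else chi p ((i / p ^ padicValNat p i : ℕ) : ZMod p)

lemma two_dh (p : ℕ) [hp : Fact p.Prime] (i : ℕ) :
    2 * (dh p i : ℤ) = 1 + (if i = 0 then 1 else 0) - cc p i := by
  unfold dh cc
  by_cases hi : i = 0
  · simp [hi]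
  · have hu : ((i / p ^ padicValNat p i : ℕ) : ZMod p) ≠ 0 := by
      rw [Ne, ZMod.natCast_eq_zero_iff, ← Nat.factorization_def i hp.out]
      exact Nat.not_dvd_ordCompl hp.out hi
    simp only [hi, false_or, if_false]
    by_cases hs : IsSquare ((i / p ^ padicValNat p i : ℕ) : ZMod p)
    · have : chi p ((i / p ^ padicValNat p i : ℕ) : ZMod p) = 1 :=
        (quadraticChar_one_iff_isSquare hu).2 hs
      rw [this]; simp [hs]
    · have : chi p ((i / p ^ padicValNat p i : ℕ) : ZMod p) = -1 :=
        quadraticChar_neg_one_iff_not_isSquare.2 hs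
      rw [this]; simp [hs]

lemma cc_step (p : ℕ) [hp : Fact p.Prime] (b a : ℕ) (ha : a < p) :
    cc p (p * b + a) = chi p (a : ZMod p) + if a = 0 then cc p b else 0 := by
  by_cases h0 : a = 0
  · subst h0
    have hc : chi p ((0 : ℕ) : ZMod p) = 0 := by simp [chi]
    rw [hc]
    simp only [add_zero, if_true, zero_add]
    unfold cc
    by_cases hb : b = 0
    · simp [hb]
    · have hpos := hp.out.pos
      rw [if_neg (by positivity), if_neg hb, padicValNat.mul hp.out.ne_zero hb,
        padicValNat.self hp.out.one_lt, pow_add, pow_one, Nat.mul_div_mul_left _ _ hpos]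
  · have hnd : ¬ p ∣ p * b + a := by
      intro h
      have := (Nat.dvd_add_right (dvd_mul_right p b)).1 h
      exact h0 (Nat.eq_zero_of_dvd_of_lt this ha)
    unfold cc
    rw [if_neg (by omega), padicValNat.eq_zero_of_not_dvd hnd]
    simp [h0]

lemma sum_blocks {F : Type*} [AddCommMonoid F] (p m : ℕ) (f : ℕ → F) :
    ∑ i ∈ Finset.range (p * m), f i =
      ∑ b ∈ Finset.range m, ∑ a ∈ Finset.range p, f (p * b + a) := by
  induction m with
  | zero => simp
  | succ m ih => rw [Nat.mul_succ, Finset.sum_range_add, ih, Finset.sum_range_succ]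

/-- Generating sum of the signed sequence. -/
noncomputable def GG (p : ℕ) [Fact p.Prime] {F : Type*} [Field F] (n : ℕ) (z : F) : F :=
  ∑ i ∈ Finset.range (p ^ n), (cc p i : F) * z ^ i

/-- Gauss sum. -/
noncomputable def gs (p : ℕ) [Fact p.Prime] {F : Type*} [Field F] (z : F) : F :=
  ∑ a ∈ Finset.range p, (chi p (a : ZMod p) : F) * z ^ a

lemma GG_step (p : ℕ) [hp : Fact p.Prime] {F : Type*} [Field F] (n : ℕ) (z : F) :
    GG p (n + 1) z = gs p z * (∑ b ∈ Finset.range (p ^ n), (z ^ p) ^ b) + GG p n (z ^ p) := by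
  unfold GG
  rw [pow_succ', sum_blocks, Finset.mul_sum, ← Finset.sum_add_distrib]
  refine Finset.sum_congr rfl fun b _ => ?_
  have : ∀ a ∈ Finset.range p, (cc p (p * b + a) : F) * z ^ (p * b + a) =
      (chi p (a : ZMod p) : F) * z ^ a * (z ^ p) ^ b +
        if a = 0 then (cc p b : F) * (z ^ p) ^ b else 0 := by
    intro a ha
    rw [cc_step p b a (Finset.mem_range.1 ha), pow_add, pow_mul]
    split_ifs with h
    · subst h; push_cast; ring
    · push_cast; ring
  rw [Finset.sum_congr rfl this, Finset.sum_add_distrib, gs, Finset.sum_mul,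
    Finset.sum_ite_eq' (Finset.range p) 0]
  simp [hp.out.pos]

lemma sum_range_zmod_s18 (p : ℕ) [hp : Fact p.Prime] {F : Type*} [AddCommMonoid F] (f : ZMod p → F) :
    ∑ a ∈ Finset.range p, f (a : ZMod p) = ∑ x : ZMod p, f x := by
  refine Finset.sum_bij' (fun a _ => (a : ZMod p)) (fun x _ => x.val) ?_ ?_ ?_ ?_ ?_
  · simp
  · intro x _; simpa using ZMod.val_lt x
  · intro a ha; exact ZMod.val_cast_of_lt (Finset.mem_range.1 ha)
  · intro x _; simp
  · simp

lemma gs_one (p : ℕ) [hp : Fact p.Prime] (hodd : Odd p) {F : Type*} [Field F] :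
    gs p (1 : F) = 0 := by
  have h2 : ringChar (ZMod p) ≠ 2 := by
    rw [ZMod.ringChar_zmod_n]; rintro rfl; exact absurd hodd (by decide)
  have := quadraticChar_sum_zero h2
  have h3 : ∑ a ∈ Finset.range p, chi p (a : ZMod p) = 0 := by
    rw [sum_range_zmod_s18 p (fun x => chi p x)]; exact this
  unfold gs
  simp only [one_pow, mul_one]
  exact_mod_cast congrArg (Int.cast : ℤ → F) h3

lemma gs_sq (p : ℕ) [hp : Fact p.Prime] (hodd : Odd p) {F : Type*} [Field F]
    (hF : ringChar F ≠ 2) (z : F) (hz : z ^ p = 1) (hz1 : z ≠ 1) :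
    gs p z ^ 2 = (chi p (-1) : F) * p := by
  have h2 : ringChar (ZMod p) ≠ 2 := by
    rw [ZMod.ringChar_zmod_n]; rintro rfl; exact absurd hodd (by decide)
  have hprim : IsPrimitiveRoot z p := by
    have := orderOf_eq_prime hz hz1
    rw [← this]; exact IsPrimitiveRoot.orderOf z
  have hq : ((chi p).ringHomComp (Int.castRingHom F)).IsQuadratic :=
    MulChar.IsQuadratic.comp (quadraticChar_isQuadratic (ZMod p)) _
  have hne : ((chi p).ringHomComp (Int.castRingHom F)) ≠ 1 := by
    obtain ⟨a, ha⟩ := quadraticChar_exists_neg_one' h2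
    intro h
    have h1 := congrArg (fun c : MulChar (ZMod p) F => c a) h
    have ha' : chi p (a : ZMod p) = -1 := ha
    simp only [MulChar.ringHomComp_apply, MulChar.one_apply_coe, ha'] at h1
    exact Ring.neg_one_ne_one_of_char_ne_two hF (by simpa using h1)
  have key := gaussSum_sq hne hq (AddChar.zmodChar_primitive_of_primitive_root p hprim)
  rw [ZMod.card] at key
  rw [MulChar.ringHomComp_apply] at key
  rw [show (chi p (-1) : F) = Int.castRingHom F (chi p (-1)) from rfl, ← key]
  congr 1
  unfold gs gaussSum
  rw [← sum_range_zmod_s18 p]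
  refine Finset.sum_congr rfl fun a _ => ?_
  rw [AddChar.zmodChar_apply', MulChar.ringHomComp_apply]
  rfl

lemma GG_one (p : ℕ) [hp : Fact p.Prime] (hodd : Odd p) {F : Type*} [Field F] (n : ℕ) :
    GG p n (1 : F) = 0 := by
  induction n with
  | zero => simp [GG, cc]
  | succ n ih => rw [GG_step, gs_one p hodd, one_pow, ih]; simp

lemma geom_zero {F : Type*} [Field F] (z : F) (m : ℕ) (h : z ^ m = 1) (h1 : z ≠ 1) :
    ∑ b ∈ Finset.range m, z ^ b = 0 := by
  have := geom_sum_mul z m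
  rw [h, sub_self] at this
  exact (mul_eq_zero.1 this).resolve_right (sub_ne_zero.2 h1)

lemma GG_sq (p : ℕ) [hp : Fact p.Prime] (hodd : Odd p) {F : Type*} [Field F]
    (hF : ringChar F ≠ 2) (n : ℕ) : ∀ z : F, z ^ p ^ n = 1 → z ≠ 1 →
    ∃ m < n, GG p n z ^ 2 = (chi p (-1) : F) * p ^ (2 * m + 1) := by
  induction n with
  | zero => intro z hz h1; simp at hz; exact absurd hz h1
  | succ n ih =>
    intro z hz h1
    rw [GG_step]
    by_cases h : z ^ p = 1
    · refine ⟨n, by omega, ?_⟩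
      rw [h, GG_one p hodd, add_zero, mul_pow, gs_sq p hodd hF z h h1]
      simp only [one_pow, Finset.sum_const, Finset.card_range, nsmul_eq_mul, mul_one]
      push_cast
      ring
    · have hz' : (z ^ p) ^ p ^ n = 1 := by rw [← pow_mul, ← pow_succ']; exact hz
      obtain ⟨m, hm, he⟩ := ih (z ^ p) hz' h
      refine ⟨m, by omega, ?_⟩
      rw [geom_zero _ _ hz' h, mul_zero, zero_add, he]

lemma circ_sing {F : Type*} [Field F] (N : ℕ) (s : ℕ → F) (w : F) (hw : orderOf w = N)
    (hN : 0 < N) (B : Matrix (Fin N) (Fin N) F) (hB : ∀ i j, B i j = s ((i - j : Fin N).val))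
    (hdet : B.det = 0) : ∃ z : F, z ^ N = 1 ∧ ∑ i ∈ Finset.range N, s i * z ^ i = 0 := by
  have : NeZero N := ⟨hN.ne'⟩
  have hwN : w ^ N = 1 := hw ▸ pow_orderOf_eq_one w
  by_contra hcon
  push Not at hcon
  obtain ⟨v, hv, hBv⟩ := Matrix.exists_mulVec_eq_zero_iff.2 hdet
  apply hv
  refine Matrix.eq_zero_of_forall_pow_sum_mul_pow_eq_zero (f := fun j : Fin N => w ^ (j : ℕ)) ?_ ?_
  · intro i j hij
    have := pow_injOn_Iio_orderOf (x := w) (by simp [hw]) (by simp [hw]) hij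
    exact Fin.ext this
  · intro k
    set z := w ^ (k : ℕ) with hzdef
    have hz : z ^ N = 1 := by rw [hzdef, ← pow_mul, mul_comm, pow_mul, hwN, one_pow]
    have hS := hcon z hz
    have hz0 : z ≠ 0 := by rintro h; rw [h, zero_pow hN.ne'] at hz; exact zero_ne_one hz
    have hcol : ∀ j : Fin N, ∑ i : Fin N, z ^ (i : ℕ) * B i j =
        z ^ (j : ℕ) * ∑ i ∈ Finset.range N, s i * z ^ i := by
      intro j
      rw [Finset.sum_range, Finset.mul_sum]
      refine Fintype.sum_equiv (Equiv.subRight j) _ _ fun i => ?_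
      rw [hB, Equiv.subRight_apply]
      have : z ^ (i : ℕ) = z ^ (j : ℕ) * z ^ ((i - j : Fin N) : ℕ) := by
        rw [← pow_add]
        conv_lhs => rw [show i = j + (i - j) by abel, Fin.val_add]
        rw [← pow_eq_pow_mod _ hz]
      rw [this]; ring
    have h0 : ∑ i : Fin N, z ^ (i : ℕ) * (B.mulVec v) i = 0 := by rw [hBv]; simp
    have h1 : (∑ j : Fin N, v j * z ^ (j : ℕ)) * ∑ i ∈ Finset.range N, s i * z ^ i = 0 := by
      have h3 : ∑ i : Fin N, z ^ (i : ℕ) * (B.mulVec v) i =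
          ∑ j : Fin N, ∑ i : Fin N, z ^ (i : ℕ) * (B i j * v j) := by
        rw [Finset.sum_comm]
        refine Finset.sum_congr rfl fun i _ => ?_
        rw [← Finset.mul_sum]
        rfl
      rw [← h0, h3, Finset.sum_mul]
      refine Finset.sum_congr rfl fun j _ => ?_
      rw [mul_assoc, ← hcol, Finset.mul_sum]
      refine Finset.sum_congr rfl fun i _ => ?_
      ring
    have h2 := (mul_eq_zero.1 h1).resolve_right hS
    rw [← h2]
    refine Finset.sum_congr rfl fun j _ => ?_
    rw [hzdef, ← pow_mul, ← pow_mul, mul_comm (j : ℕ)]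

lemma arith_minus (p n q r : ℕ) (hp : 3 ≤ p) (hr0 : 0 < r) (hr : r < 2 * n)
    (hq : 2 * p ^ n + 1 ≤ q) (hqN : p ^ n ∣ q - 1) : ¬ q ∣ p ^ r - 1 := by
  rintro ⟨t, ht⟩
  have h1 : 1 < p ^ r := Nat.one_lt_pow hr0.ne' (by omega)
  have hN : 0 < p ^ n := by positivity
  have ht0 : 0 < t := by
    rcases Nat.eq_zero_or_pos t with h | h
    · subst h; omega
    · exact h
  rcases lt_or_ge r n with h | h
  · have : p ^ r ≤ p ^ n := Nat.pow_le_pow_right (by omega) h.le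
    have : q ≤ q * t := Nat.le_mul_of_pos_right q ht0
    omega
  · have hd : p ^ n ∣ p ^ r := pow_dvd_pow p h
    have he : p ^ r = (q - 1) * t + (t + 1) := by
      obtain ⟨q', rfl⟩ : ∃ q', q = q' + 1 := ⟨q - 1, by omega⟩
      have : p ^ r = (q' + 1) * t + 1 := by omega
      rw [this]; simp; ring
    rw [he, Nat.dvd_add_right (hqN.mul_right t)] at hd
    have h3 := Nat.le_of_dvd (by omega) hd
    have h4 : p ^ r * p ≤ p ^ n * p ^ n := by
      rw [← pow_succ, ← pow_add]; exact Nat.pow_le_pow_right (by omega) (by omega)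
    have h5 : p ^ r = q * t + 1 := by omega
    have h6 : p ≤ p ^ n := by
      calc p = p ^ 1 := (pow_one p).symm
        _ ≤ p ^ n := Nat.pow_le_pow_right (by omega) (by omega)
    have h7 : p ^ r * 3 ≤ p ^ n * p ^ n := le_trans (Nat.mul_le_mul_left _ hp) h4
    have h8 : (2 * p ^ n + 1) * t ≤ q * t := Nat.mul_le_mul_right _ hq
    nlinarith

lemma arith_plus (p n q r : ℕ) (hp : 3 ≤ p) (hpo : Odd p) (hqo : Odd q) (hr : r < 2 * n)
    (hq : 2 * p ^ n + 1 ≤ q) (hqN : p ^ n ∣ q - 1) : ¬ q ∣ p ^ r + 1 := by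
  rintro ⟨t, ht⟩
  have hN : 0 < p ^ n := by positivity
  have ht0 : 0 < t := by
    rcases Nat.eq_zero_or_pos t with h | h
    · subst h; omega
    · exact h
  rcases lt_or_ge r n with h | h
  · have : p ^ r ≤ p ^ n := Nat.pow_le_pow_right (by omega) h.le
    nlinarith
  · have hd : p ^ n ∣ p ^ r := pow_dvd_pow p h
    have he : p ^ r = (q - 1) * t + (t - 1) := by
      obtain ⟨q', rfl⟩ : ∃ q', q = q' + 1 := ⟨q - 1, by omega⟩
      obtain ⟨t', rfl⟩ : ∃ t', t = t' + 1 := ⟨t - 1, by omega⟩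
      simp; nlinarith
    rw [he, Nat.dvd_add_right (hqN.mul_right t)] at hd
    have ht1 : t ≠ 1 := by
      rintro rfl
      have := hpo.pow (n := r)
      rw [mul_one] at ht
      rw [← ht] at hqo
      exact (Nat.not_even_iff_odd.2 hqo) this.add_one
    have h3 := Nat.le_of_dvd (by omega) hd
    have h4 : p ^ r ≤ p ^ n * p ^ n := by
      rw [← pow_add]; exact Nat.pow_le_pow_right (by omega) (by omega)
    have h8 : (2 * p ^ n + 1) * t ≤ q * t := Nat.mul_le_mul_right _ hq
    have h9 : p ^ n + 1 ≤ t := by omega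
    nlinarith

theorem stmt_18 (p n : ℕ) (hp : p.Prime) (hodd : Odd p) (hn : 0 < n)
    (A : Matrix (Fin (p ^ n)) (Fin (p ^ n)) ℤ)
    (hA : ∀ i j : Fin (p ^ n), A i j = (dh p ((i - j : Fin (p ^ n)).val) : ℤ)) :
    Nat.gcd A.det.natAbs (2 ^ p ^ n - 1) ∣ 2 ^ p ^ (n - 1) - 1 := by
  have : Fact p.Prime := ⟨hp⟩
  have hp3 : 3 ≤ p := by
    have := hp.two_le
    rcases hodd with ⟨k, hk⟩; omega
  obtain ⟨k, rfl⟩ : ∃ k, n = k + 1 := ⟨n - 1, by omega⟩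
  simp only [Nat.add_sub_cancel]
  set X := 2 ^ p ^ k with hX
  have hX1 : 1 ≤ X := Nat.one_le_two_pow
  have hfac : 2 ^ p ^ (k + 1) - 1 = (∑ i ∈ Finset.range p, X ^ i) * (X - 1) := by
    have h1 : 2 ^ p ^ (k + 1) = X ^ p := by rw [hX, ← pow_mul, pow_succ]
    rw [h1]
    have h2 := geom_sum_mul (X : ℤ) p
    zify [hX1, Nat.one_le_pow p X hX1]
    exact h2.symm
  rw [hfac]
  have hcop : Nat.Coprime A.det.natAbs (∑ i ∈ Finset.range p, X ^ i) := by
    by_contra hnc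
    obtain ⟨q, hq, hqd, hqs⟩ := Nat.Prime.not_coprime_iff_dvd.1 hnc
    have : Fact q.Prime := ⟨hq⟩
    have h2N : (2 : ZMod q) ^ p ^ (k + 1) = 1 := by
      have : q ∣ 2 ^ p ^ (k + 1) - 1 := hfac ▸ hqs.mul_right _
      rw [← ZMod.natCast_eq_zero_iff, Nat.cast_sub Nat.one_le_two_pow] at this
      push_cast at this
      exact sub_eq_zero.1 this
    have hpp : 0 < p ^ (k + 1) := pow_pos hp.pos _
    have h20 : (2 : ZMod q) ≠ 0 := by
      intro h; rw [h, zero_pow hpp.ne'] at h2N; exact zero_ne_one h2N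
    have hq2 : q ≠ 2 := by
      rintro rfl; exact h20 rfl
    have h2k : (2 : ZMod q) ^ p ^ k ≠ 1 := by
      intro h
      have hs := (ZMod.natCast_eq_zero_iff _ _).2 hqs
      rw [hX] at hs
      push_cast at hs
      rw [h] at hs
      simp only [one_pow, Finset.sum_const, Finset.card_range, nsmul_eq_mul, mul_one] at hs
      have hqp : q = p := (Nat.prime_dvd_prime_iff_eq hq hp).1 ((ZMod.natCast_eq_zero_iff _ _).1 hs)
      subst hqp
      rw [ZMod.pow_card_pow] at h
      have : (1 : ZMod q) = 0 := by linear_combination h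
      exact one_ne_zero this
    have hord : orderOf (2 : ZMod q) = p ^ (k + 1) := orderOf_eq_prime_pow h2k h2N
    have hdvd : p ^ (k + 1) ∣ q - 1 := hord ▸ ZMod.orderOf_dvd_card_sub_one h20
    have hqo : Odd q := hq.odd_of_ne_two hq2
    have hNo : Odd (p ^ (k + 1)) := hodd.pow
    have hqge : 2 * p ^ (k + 1) + 1 ≤ q := by
      have hev : 2 ∣ q - 1 := by rcases hqo with ⟨a, ha⟩; omega
      have := Nat.Coprime.mul_dvd_of_dvd_of_dvd (Nat.coprime_two_left.2 hNo) hev hdvd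
      have := Nat.le_of_dvd (by have := hq.two_le; omega) this
      have := hq.two_le
      omega
    have hF : ringChar (ZMod q) ≠ 2 := by rw [ZMod.ringChar_zmod_n]; exact hq2
    obtain ⟨z, hz, hS⟩ := circ_sing (p ^ (k + 1)) (fun i => (dh p i : ZMod q)) 2 hord hpp
      (A.map (Int.castRingHom (ZMod q))) (by intro i j; simp [hA]) (by
        have h1 : ((A.det : ℤ) : ZMod q) = 0 :=
          (ZMod.intCast_zmod_eq_zero_iff_dvd _ _).2 (Int.natCast_dvd.2 hqd)
        have h2 := RingHom.map_det (Int.castRingHom (ZMod q)) A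
        rw [RingHom.mapMatrix_apply] at h2
        rw [← h2]; exact h1)
    have h2S : (∑ i ∈ Finset.range (p ^ (k + 1)), z ^ i) + 1 - GG p (k + 1) z = 0 := by
      have : 2 * ∑ i ∈ Finset.range (p ^ (k + 1)), (dh p i : ZMod q) * z ^ i =
          (∑ i ∈ Finset.range (p ^ (k + 1)), z ^ i) + 1 - GG p (k + 1) z := by
        have hone : (1 : ZMod q) = ∑ i ∈ Finset.range (p ^ (k + 1)),
            if i = 0 then (1 : ZMod q) else 0 := by
          rw [Finset.sum_ite_eq' (Finset.range (p ^ (k + 1))) 0]; simp [hp.pos]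
        rw [GG, hone, Finset.mul_sum, ← Finset.sum_add_distrib, ← Finset.sum_sub_distrib]
        refine Finset.sum_congr rfl fun i _ => ?_
        have h := congrArg (Int.cast : ℤ → ZMod q) (two_dh p i)
        push_cast at h
        rw [← mul_assoc, h]
        split_ifs with hi
        · subst hi; simp
        · ring
      rw [← this, hS, mul_zero]
    by_cases hz1 : z = 1
    · subst hz1
      rw [GG_one p hodd] at h2S
      have : ((p ^ (k + 1) + 1 : ℕ) : ZMod q) = 0 := by
        push_cast; simpa using h2S
      have := Nat.le_of_dvd (by omega) ((ZMod.natCast_eq_zero_iff _ _).1 this)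
      omega
    · rw [geom_zero z _ hz hz1] at h2S
      have hG : GG p (k + 1) z = 1 := by linear_combination -h2S
      obtain ⟨m, hm, he⟩ := GG_sq p hodd hF (k + 1) z hz hz1
      rw [hG, one_pow] at he
      have hpr : 1 ≤ p ^ (2 * m + 1) := Nat.one_le_pow _ _ hp.pos
      rcases quadraticChar_dichotomy (F := ZMod p) (a := -1) (by simp) with h | h
      · have h' : chi p (-1) = 1 := h
        rw [h'] at he
        refine arith_minus p (k + 1) q (2 * m + 1) hp3 (by omega) (by omega) hqge hdvd ?_
        rw [← ZMod.natCast_eq_zero_iff, Nat.cast_sub hpr]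
        push_cast at he ⊢
        linear_combination -he
      · have h' : chi p (-1) = -1 := h
        rw [h'] at he
        refine arith_plus p (k + 1) q (2 * m + 1) hp3 hodd hqo (by omega) hqge hdvd ?_
        rw [← ZMod.natCast_eq_zero_iff]
        push_cast at he ⊢
        linear_combination he
  rw [Nat.Coprime.gcd_mul_left_cancel_right _ hcop.symm]
  exact Nat.gcd_dvd_right _ _
end

section
/- Let p be an odd prime, n a positive integer, N = p^n, and let (s_i)_{0≤i<N} be the Ding–Helleseth generalized cyclotomic sequence of period N. Then the 2-adic complexity Φ_2(s) = ⌊log_2((2^N − 1)/gcd(S(2), 2^N − 1))⌋ satisfies Φ_2(s) ≥ p^n − p^{n-1} − 1. -/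
open scoped Classical

lemma dh_mul (p : ℕ) (hp : p.Prime) (k : ℕ) : dh p (p * k) = dh p k := by
  have := Fact.mk hp
  rcases Nat.eq_zero_or_pos k with rfl | hk
  · simp
  · have h1 : padicValNat p (p * k) = padicValNat p k + 1 := by
      rw [padicValNat.mul hp.ne_zero hk.ne', padicValNat.self hp.one_lt]; ring
    have h2 : p * k / p ^ padicValNat p (p * k) = k / p ^ padicValNat p k := by
      rw [h1, pow_succ', Nat.mul_div_mul_left _ _ hp.pos]
    unfold dh
    rw [h2]
    simp [hp.ne_zero]

lemma dh_of_not_dvd (p : ℕ) (i : ℕ) (h : ¬ p ∣ i) :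
    dh p i = if IsSquare ((i : ℕ) : ZMod p) then 0 else 1 := by
  have h0 : i ≠ 0 := by rintro rfl; simp at h
  unfold dh
  rw [padicValNat.eq_zero_of_not_dvd h]
  by_cases hs : IsSquare ((i : ℕ) : ZMod p) <;> simp [h0, hs]

lemma dh_add (p a k : ℕ) (ha : ¬ p ∣ a) : dh p (a + p * k) = dh p a := by
  rw [dh_of_not_dvd p a ha, dh_of_not_dvd p (a + p * k)]
  · simp
  · rwa [Nat.dvd_add_left (Dvd.intro _ rfl)]

lemma sum_range_mul' {R : Type*} [AddCommMonoid R] (p m : ℕ) (f : ℕ → R) :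
    ∑ i ∈ Finset.range (p * m), f i
      = ∑ k ∈ Finset.range m, ∑ a ∈ Finset.range p, f (a + p * k) := by
  induction m with
  | zero => simp
  | succ m ih =>
    rw [Nat.mul_succ, Finset.sum_range_add, ih, Finset.sum_range_succ]
    simp only [add_comm]

lemma step {F : Type*} [Field F] (p : ℕ) (hp : p.Prime) (m : ℕ) (x : F)
    (hx : x ^ (p * m) = 1) (hx1 : x ^ p ≠ 1) :
    ∑ i ∈ Finset.range (p * m), (dh p i : F) * x ^ i
      = ∑ i ∈ Finset.range m, (dh p i : F) * (x ^ p) ^ i := by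
  rw [sum_range_mul', Finset.sum_comm]
  have hg : ∑ k ∈ Finset.range m, (x ^ p) ^ k = 0 := by
    have h := geom_sum_mul (x ^ p) m
    rw [← pow_mul, hx, sub_self] at h
    exact (mul_eq_zero.mp h).resolve_right (sub_ne_zero.mpr hx1)
  rw [Finset.sum_eq_single_of_mem 0 (Finset.mem_range.mpr hp.pos)]
  · refine Finset.sum_congr rfl fun k _ => ?_
    rw [zero_add, dh_mul p hp, pow_mul]
  · intro a ha ha0
    have hna : ¬ p ∣ a := fun h =>
      absurd (Nat.le_of_dvd (Nat.pos_of_ne_zero ha0) h) (by simpa using ha)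
    calc _ = ∑ k ∈ Finset.range m, (dh p a : F) * x ^ a * (x ^ p) ^ k := by
          refine Finset.sum_congr rfl fun k _ => ?_
          rw [dh_add p a k hna, pow_add, pow_mul]; ring
      _ = 0 := by rw [← Finset.mul_sum, hg, mul_zero]

lemma reduce {F : Type*} [Field F] (p : ℕ) (hp : p.Prime) (n : ℕ) :
    ∀ x : F, x ^ p ^ (n + 1) = 1 → x ^ p ^ n ≠ 1 →
    ∑ i ∈ Finset.range (p ^ (n + 1)), (dh p i : F) * x ^ i
      = ∑ i ∈ Finset.range p, (dh p i : F) * (x ^ p ^ n) ^ i := by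
  induction n with
  | zero => intro x _ _; simp
  | succ n ih =>
    intro x h1 h2
    have e : p ^ (n + 1 + 1) = p * p ^ (n + 1) := pow_succ' _ _
    have e' : p ^ (n + 1) = p * p ^ n := pow_succ' _ _
    rw [e, step p hp _ x (by rw [← e]; exact h1), ih (x ^ p)]
    · rw [← pow_mul x, ← e']
    · rw [← pow_mul, ← e]; exact h1
    · rw [← pow_mul, ← e']; exact h2
    · intro h
      apply h2
      rw [e', pow_mul, h, one_pow]

lemma base {F : Type*} [Field F] (p : ℕ) [hp : Fact p.Prime] (hodd : Odd p) (z : F)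
    (hz : z ^ p = 1) (hz1 : z ≠ 1) (hF : ringChar F ≠ 2)
    (h0 : ∑ i ∈ Finset.range p, (dh p i : F) * z ^ i = 0) :
    (p : F) = 1 ∨ (p : F) = -1 := by
  have : NeZero p := ⟨hp.out.ne_zero⟩
  have hchar : ringChar (ZMod p) ≠ 2 := by
    rw [ZMod.ringChar_zmod_n]; rintro rfl; exact absurd hodd (by decide)
  set χ : MulChar (ZMod p) F :=
    (quadraticChar (ZMod p)).ringHomComp (Int.castRingHom F) with hχ
  set ψ : AddChar (ZMod p) F := AddChar.zmodChar p hz with hψ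
  have hprim : ψ.IsPrimitive :=
    AddChar.zmodChar_primitive_of_primitive_root p
      (orderOf_eq_prime hz hz1 ▸ IsPrimitiveRoot.orderOf z)
  have hquad : χ.IsQuadratic := (quadraticChar_isQuadratic (ZMod p)).comp _
  have hne : χ ≠ 1 := by
    obtain ⟨a, ha⟩ := quadraticChar_exists_neg_one' hchar
    intro h
    have h1 : χ a = 1 := by rw [h]; simp
    rw [hχ, MulChar.ringHomComp_apply, ha] at h1
    simp at h1
    exact Ring.neg_one_ne_one_of_char_ne_two hF h1
  have hsq := gaussSum_sq hne hquad hprim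
  have hG : gaussSum χ ψ = 1 := by
    have hgeom : ∑ i ∈ Finset.range p, z ^ i = 0 := by
      have h := geom_sum_mul z p
      rw [hz, sub_self] at h
      exact (mul_eq_zero.mp h).resolve_right (sub_ne_zero.mpr hz1)
    have hs : gaussSum χ ψ = ∑ i ∈ Finset.range p, χ (i : ZMod p) * z ^ i := by
      unfold gaussSum
      refine Finset.sum_bij' (fun a _ => a.val) (fun i _ => (i : ZMod p)) ?_ ?_ ?_ ?_ ?_
      · intro a _; simpa using ZMod.val_lt a
      · simp
      · intro a _; simp
      · intro i hi; exact ZMod.val_cast_of_lt (by simpa using hi)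
      · intro a _; simp [hψ, AddChar.zmodChar_apply]
    have key : ∑ i ∈ Finset.range p, (2 * (dh p i : F) - 1 + χ (i : ZMod p)) * z ^ i = 1 := by
      rw [Finset.sum_eq_single_of_mem 0 (Finset.mem_range.mpr hp.out.pos)]
      · simp [dh]; norm_num; exact MulChar.map_zero χ
      · intro i hi hi0
        have hna : ¬ p ∣ i := fun h =>
          absurd (Nat.le_of_dvd (Nat.pos_of_ne_zero hi0) h) (by simpa using hi)
        have hi' : (i : ZMod p) ≠ 0 := by
          rwa [Ne, ZMod.natCast_eq_zero_iff]
        rw [dh_of_not_dvd p i hna, hχ, MulChar.ringHomComp_apply]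
        by_cases hsq : IsSquare (i : ZMod p)
        · rw [(quadraticChar_one_iff_isSquare hi').mpr hsq]; simp [hsq]
        · rw [quadraticChar_neg_one_iff_not_isSquare.mpr hsq]; simp [hsq]; left; norm_num
    have expand : ∑ i ∈ Finset.range p, (2 * (dh p i : F) - 1 + χ (i : ZMod p)) * z ^ i
        = 2 * (∑ i ∈ Finset.range p, (dh p i : F) * z ^ i) - (∑ i ∈ Finset.range p, z ^ i)
          + ∑ i ∈ Finset.range p, χ (i : ZMod p) * z ^ i := by
      rw [Finset.mul_sum, ← Finset.sum_sub_distrib, ← Finset.sum_add_distrib]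
      refine Finset.sum_congr rfl fun i _ => ?_
      ring
    rw [key, h0, hgeom, ← hs] at expand
    simpa using expand.symm
  rw [hG, ZMod.card] at hsq
  rcases hquad (-1) with h | h | h <;> rw [h] at hsq
  · simp at hsq
  · left; simpa using hsq.symm
  · right; linear_combination hsq

lemma cop (p n : ℕ) (hp : p.Prime) (hodd : Odd p) :
    Nat.Coprime (∑ i ∈ Finset.range (p ^ (n + 1)), dh p i * 2 ^ i)
      (∑ k ∈ Finset.range p, (2 ^ p ^ n) ^ k) := by
  have := Fact.mk hp
  refine Nat.Coprime.symm (Nat.coprime_of_dvd ?_)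
  intro q hq h2 h1
  have := Fact.mk hq
  have hS := (ZMod.natCast_eq_zero_iff _ _).mpr h1
  have hP := (ZMod.natCast_eq_zero_iff _ _).mpr h2
  push_cast at hS hP
  have hz : ((2 : ZMod q) ^ p ^ n) ^ p = 1 := by
    have h := geom_sum_mul ((2 : ZMod q) ^ p ^ n) p
    rw [hP, zero_mul] at h
    exact (sub_eq_zero.mp h.symm)
  have hx : (2 : ZMod q) ^ p ^ (n + 1) = 1 := by rw [pow_succ, pow_mul]; exact hz
  have hz1 : (2 : ZMod q) ^ p ^ n ≠ 1 := by
    intro h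
    rw [h] at hP
    simp at hP
    have hqp : q = p := (Nat.prime_dvd_prime_iff_eq hq hp).mp ((ZMod.natCast_eq_zero_iff _ _).mp hP)
    subst hqp
    rw [ZMod.pow_card_pow] at hx
    exact one_ne_zero (α := ZMod q) (by linear_combination hx)
  have hq2 : q ≠ 2 := by
    rintro rfl
    have : (2 : ZMod 2) = 0 := rfl
    rw [this, zero_pow (pow_ne_zero _ hp.ne_zero)] at hx
    exact zero_ne_one hx
  rw [reduce p hp n 2 hx hz1] at hS
  have hb := base p hodd _ hz hz1 (by rwa [ZMod.ringChar_zmod_n]) hS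
  have hord : p ∣ q - 1 := by
    have h := orderOf_eq_prime hz hz1
    rw [← h]
    apply ZMod.orderOf_dvd_card_sub_one
    intro h0; rw [h0, zero_pow hp.ne_zero] at hz; exact zero_ne_one hz
  have hle : p ≤ q - 1 := Nat.le_of_dvd (Nat.sub_pos_of_lt hq.one_lt) hord
  have hp1 := hp.two_le
  rcases hb with h | h
  · have : ((p - 1 : ℕ) : ZMod q) = 0 := by
      rw [Nat.cast_sub hp.one_le, h]; simp
    have := Nat.le_of_dvd (by omega) ((ZMod.natCast_eq_zero_iff _ _).mp this)
    omega
  · have : ((p + 1 : ℕ) : ZMod q) = 0 := by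
      push_cast; rw [h]; simp
    have := Nat.le_of_dvd (by omega) ((ZMod.natCast_eq_zero_iff _ _).mp this)
    have := hq.odd_of_ne_two hq2
    grind

theorem stmt_19 (p n : ℕ) (hp : p.Prime) (hodd : Odd p) (hn : 0 < n) :
    p ^ n - p ^ (n - 1) - 1 ≤
      Nat.log 2 ((2 ^ p ^ n - 1) /
        Nat.gcd (∑ i ∈ Finset.range (p ^ n), dh p i * 2 ^ i) (2 ^ p ^ n - 1)) := by
  obtain ⟨m, rfl⟩ : ∃ m, n = m + 1 := ⟨n - 1, by omega⟩
  rw [Nat.add_sub_cancel]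
  have hcop := cop p m hp hodd
  set S := ∑ i ∈ Finset.range (p ^ (m + 1)), dh p i * 2 ^ i
  set P := ∑ k ∈ Finset.range p, (2 ^ p ^ m) ^ k with hP
  have hone : 1 < 2 ^ p ^ m := Nat.one_lt_two_pow (pow_ne_zero _ hp.ne_zero)
  have hfac : 2 ^ p ^ (m + 1) - 1 = P * (2 ^ p ^ m - 1) := by
    have h := Nat.geomSum_eq hone p
    have hd : (2 ^ p ^ m - 1) ∣ (2 ^ p ^ m) ^ p - 1 := by
      simpa using Nat.sub_dvd_pow_sub_pow (2 ^ p ^ m) 1 p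
    rw [hP, h, Nat.div_mul_cancel hd, ← pow_mul, ← pow_succ]
  have hPge : 2 ^ (p ^ (m + 1) - p ^ m) ≤ P := by
    have h : (2 ^ p ^ m) ^ (p - 1) ≤ P :=
      Finset.single_le_sum (f := fun k => (2 ^ p ^ m) ^ k) (fun _ _ => Nat.zero_le _)
        (Finset.mem_range.mpr (Nat.sub_lt hp.pos one_pos))
    rwa [← pow_mul, Nat.mul_sub, mul_one, ← pow_succ] at h
  rw [hfac]
  have hg : Nat.gcd S (P * (2 ^ p ^ m - 1)) ∣ 2 ^ p ^ m - 1 :=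
    (Nat.Coprime.coprime_dvd_left (Nat.gcd_dvd_left _ _) hcop).dvd_of_dvd_mul_left
      (Nat.gcd_dvd_right _ _)
  set g := Nat.gcd S (P * (2 ^ p ^ m - 1))
  have hB : 0 < 2 ^ p ^ m - 1 := by omega
  have hgpos : 0 < g := Nat.pos_of_dvd_of_pos hg hB
  have hdiv : P ≤ P * (2 ^ p ^ m - 1) / g := by
    rw [Nat.le_div_iff_mul_le hgpos]
    exact Nat.mul_le_mul_left _ (Nat.le_of_dvd hB hg)
  have h1 : p ^ (m + 1) - p ^ m ≤ Nat.log 2 (P * (2 ^ p ^ m - 1) / g) :=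
    Nat.le_log_of_pow_le (by norm_num) (hPge.trans hdiv)
  omega
end
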